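/- Let f : [a,b] → [a,b] be S-unimodal with f(a) = a, critical point c, f(c) < b, and f(x) > x for all x ∈ (a,c]. Write c₁ = f(c) and c₂ = f²(c). Then: (i) for every x ∈ (c₁, b] there is no bitrajectory of f based at x, and sα_f(x) = ∅; (ii) for every x ∈ [a, c₂) there is exactly one bitrajectory t of f based at x, this bitrajectory satisfies t(−n) → a as n → ∞, and sα_f(x) = {a}. -/

import Mathlib

open Set Filter Topology

/-- An S-unimodal map on `[a,b]`: a `C³` self-map of `[a,b]` with `f a = f b`,
`a` or `b` fixed, a unique critical point `c ∈ (a,b)` which is a maximum, nonzero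
derivative away from `c`, and negative Schwarzian derivative away from `c`. -/
structure SUnimodal (f : ℝ → ℝ) (a b c : ℝ) : Prop where
  lt_ab : a < b
  mapsTo : MapsTo f (Icc a b) (Icc a b)
  smooth : ContDiffOn ℝ 3 f (Icc a b)
  endpoints_eq : f a = f b
  fixed_endpoint : f a = a ∨ f b = b
  c_mem : c ∈ Ioo a b
  mono : StrictMonoOn f (Icc a c)
  anti : StrictAntiOn f (Icc c b)
  deriv_ne : ∀ x ∈ Icc a b, x ≠ c → deriv f x ≠ 0
  schwarzian_neg : ∀ x ∈ Icc a b, x ≠ c →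
    deriv^[3] f x / deriv f x - (3 / 2) * (deriv^[2] f x / deriv f x) ^ 2 < 0

/-- A bitrajectory of `f` based at `x` with values in the domain `D`. -/
def IsBitrajOn (f : ℝ → ℝ) (D : Set ℝ) (x : ℝ) (t : ℤ → ℝ) : Prop :=
  t 0 = x ∧ (∀ n : ℤ, t n ∈ D) ∧ ∀ n : ℤ, f (t n) = t (n + 1)

/-- The special α-limit set of `x` under `f` regarded as a map of the domain `D`. -/
def sAlphaOn (f : ℝ → ℝ) (D : Set ℝ) (x : ℝ) : Set ℝ :=
  {y | ∃ (Y : ℕ → ℝ) (k : ℕ → ℕ), Y 0 = x ∧ (∀ n, Y n ∈ D) ∧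
    (∀ n, 1 ≤ n → 1 ≤ k n ∧ f^[k n] (Y n) = Y (n - 1)) ∧
    Tendsto Y atTop (𝓝 y)}

namespace SUnimodal

variable {a b c : ℝ} {f : ℝ → ℝ}

theorem map_le_map_crit (hf : SUnimodal f a b c) {x : ℝ} (hx : x ∈ Icc a b) : f x ≤ f c := by
  have hc := hf.c_mem
  rcases le_total x c with h | h
  · exact hf.mono.monotoneOn ⟨hx.1, h⟩ ⟨hc.1.le, le_rfl⟩ h
  · exact hf.anti.antitoneOn ⟨le_rfl, hc.2.le⟩ ⟨h, hx.2⟩ h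

theorem iterate_mem (hf : SUnimodal f a b c) {x : ℝ} (hx : x ∈ Icc a b) (k : ℕ) :
    f^[k] x ∈ Icc a b :=
  hf.mapsTo.iterate k hx

/-- Every image under a positive iterate is at most the critical value. -/
theorem iterate_le_map_crit (hf : SUnimodal f a b c) {x : ℝ} (hx : x ∈ Icc a b) {k : ℕ}
    (hk : 1 ≤ k) : f^[k] x ≤ f c := by
  obtain ⟨m, rfl⟩ := Nat.exists_eq_add_of_le' hk
  rw [Function.iterate_succ_apply']
  exact hf.map_le_map_crit (hf.iterate_mem hx m)

theorem le_map_of_mem_Icc (hfa : f a = a) (hgt : ∀ x ∈ Ioc a c, x < f x) {x : ℝ}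
    (hx : x ∈ Icc a c) : x ≤ f x := by
  rcases hx.1.eq_or_lt with rfl | h
  · exact hfa.ge
  · exact (hgt x ⟨h, hx.2⟩).le

/-- A point at most `f c` mapped strictly below `f (f c)` lies on the increasing branch. -/
theorem lt_crit_of_map_lt (hf : SUnimodal f a b c) (hgt : ∀ x ∈ Ioc a c, x < f x) {x : ℝ}
    (hx : x ∈ Icc a b) (hx' : x ≤ f c) (h : f x < f (f c)) : x < c := by
  by_contra! hcx
  have hc := hf.c_mem
  have hcc := hgt c ⟨hc.1, le_rfl⟩
  have := hf.anti.antitoneOn ⟨hcx, hx.2⟩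
    ⟨hcc.le, (hf.mapsTo ⟨hc.1.le, hc.2.le⟩).2⟩ hx'
  linarith

theorem le_iterate_of_iterate_lt (hf : SUnimodal f a b c) (hfa : f a = a)
    (hgt : ∀ x ∈ Ioc a c, x < f x) (k : ℕ) {x : ℝ} (hx : x ∈ Icc a b) (hx' : x ≤ f c)
    (h : f^[k] x < f (f c)) : x ≤ f^[k] x := by
  induction k generalizing x with
  | zero => exact le_rfl
  | succ k ih =>
    rw [Function.iterate_succ_apply] at h ⊢
    have h1 := ih (hf.mapsTo hx) (hf.map_le_map_crit hx) h
    have h2 := hf.lt_crit_of_map_lt hgt hx hx' (h1.trans_lt h)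
    exact (le_map_of_mem_Icc hfa hgt ⟨hx.1, h2.le⟩).trans h1

/-- Going back `k ≥ 1` steps from a point below `f (f c)` to a point at most `f c`, one arrives on
the increasing branch, and the image of the arrival point is still at most the starting point. -/
theorem lt_crit_and_map_le (hf : SUnimodal f a b c) (hfa : f a = a)
    (hgt : ∀ x ∈ Ioc a c, x < f x) {k : ℕ} (hk : 1 ≤ k) {x : ℝ} (hx : x ∈ Icc a b)
    (hx' : x ≤ f c) (h : f^[k] x < f (f c)) : x < c ∧ f x ≤ f^[k] x := by
  obtain ⟨m, rfl⟩ := Nat.exists_eq_add_of_le' hk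
  rw [Function.iterate_succ_apply] at h ⊢
  have h1 := hf.le_iterate_of_iterate_lt hfa hgt m (hf.mapsTo hx) (hf.map_le_map_crit hx) h
  exact ⟨hf.lt_crit_of_map_lt hgt hx hx' (h1.trans_lt h), h1⟩

section BackwardOrbit

variable {Y : ℕ → ℝ} {k : ℕ → ℕ}

theorem backward_orbit (hf : SUnimodal f a b c) (hfa : f a = a)
    (hgt : ∀ x ∈ Ioc a c, x < f x) (hY0 : Y 0 < f (f c)) (hY : ∀ n, Y n ∈ Icc a b)
    (hk : ∀ n, 1 ≤ k n) (hstep : ∀ n, f^[k n] (Y (n + 1)) = Y n) (n : ℕ) :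
    Y n < f (f c) ∧ Y (n + 1) < c ∧ f (Y (n + 1)) ≤ Y n := by
  have hle (n : ℕ) : Y n ≤ f c := hstep n ▸ hf.iterate_le_map_crit (hY (n + 1)) (hk n)
  have key (n : ℕ) (h : Y n < f (f c)) : Y (n + 1) < c ∧ f (Y (n + 1)) ≤ Y n := by
    have := hf.lt_crit_and_map_le hfa hgt (hk n) (hY (n + 1)) (hle _) (by rwa [hstep n])
    rwa [hstep n] at this
  have hlt : Y n < f (f c) := by
    induction n with
    | zero => exact hY0
    | succ n ih =>
      obtain ⟨h1, h2⟩ := key n ih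
      exact ((le_map_of_mem_Icc hfa hgt ⟨(hY _).1, h1.le⟩).trans h2).trans_lt ih
  exact ⟨hlt, key n hlt⟩

theorem tendsto_backward_orbit (hf : SUnimodal f a b c) (hfa : f a = a)
    (hgt : ∀ x ∈ Ioc a c, x < f x) (hY0 : Y 0 < f (f c)) (hY : ∀ n, Y n ∈ Icc a b)
    (hk : ∀ n, 1 ≤ k n) (hstep : ∀ n, f^[k n] (Y (n + 1)) = Y n) :
    Tendsto Y atTop (𝓝 a) := by
  have H := hf.backward_orbit hfa hgt hY0 hY hk hstep
  have hmono (n : ℕ) : Y (n + 1) ≤ f (Y (n + 1)) :=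
    le_map_of_mem_Icc hfa hgt ⟨(hY _).1, (H n).2.1.le⟩
  have hanti : Antitone Y := antitone_nat_of_succ_le fun n => (hmono n).trans (H n).2.2
  have hbdd : BddBelow (range Y) := ⟨a, by rintro _ ⟨n, rfl⟩; exact (hY n).1⟩
  obtain ⟨y, hy⟩ : ∃ y, Tendsto Y atTop (𝓝 y) := ⟨_, tendsto_atTop_ciInf hanti hbdd⟩
  have hys := (tendsto_add_atTop_iff_nat 1).2 hy
  have hyab : y ∈ Icc a b := isClosed_Icc.mem_of_tendsto hy (Eventually.of_forall hY)
  have hyc : y ≤ c := le_of_tendsto hys (Eventually.of_forall fun n => (H n).2.1.le)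
  have hfy : Tendsto (fun n => f (Y (n + 1))) atTop (𝓝 (f y)) :=
    (hf.smooth.continuousOn y hyab).tendsto.comp
      (tendsto_nhdsWithin_iff.2 ⟨hys, Eventually.of_forall fun n => hY _⟩)
  have hle : f y ≤ y := le_of_tendsto_of_tendsto' hfy hy fun n => (H n).2.2
  obtain rfl : a = y := by
    by_contra hne
    exact (hgt y ⟨lt_of_le_of_ne hyab.1 hne, hyc⟩).not_ge hle
  exact hy

end BackwardOrbit

/-- Points of `[a, f (f c))` have a preimage in the same interval. -/
theorem exists_preimage (hf : SUnimodal f a b c) (hfa : f a = a)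
    (hgt : ∀ x ∈ Ioc a c, x < f x) {x : ℝ} (hx : x ∈ Ico a (f (f c))) :
    ∃ y ∈ Ico a (f (f c)), f y = x := by
  have hc := hf.c_mem
  have hcc : f (f c) ≤ f c := hf.map_le_map_crit (hf.mapsTo ⟨hc.1.le, hc.2.le⟩)
  have hcont : ContinuousOn f (Icc a c) :=
    hf.smooth.continuousOn.mono (Icc_subset_Icc_right hc.2.le)
  obtain ⟨y, hy, rfl⟩ := intermediate_value_Icc hc.1.le hcont
    (show x ∈ Icc (f a) (f c) from ⟨hfa.le.trans hx.1, hx.2.le.trans hcc⟩)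
  exact ⟨y, ⟨hy.1, (le_map_of_mem_Icc hfa hgt hy).trans_lt hx.2⟩, rfl⟩

theorem Ico_subset (hf : SUnimodal f a b c) : Ico a (f (f c)) ⊆ Icc a b := fun _ hx =>
  ⟨hx.1, hx.2.le.trans (hf.iterate_mem (Ioo_subset_Icc_self hf.c_mem) 2).2⟩

theorem exists_isBitrajOn (hf : SUnimodal f a b c) (hfa : f a = a)
    (hgt : ∀ x ∈ Ioc a c, x < f x) {x : ℝ} (hx : x ∈ Ico a (f (f c))) :
    ∃ t : ℤ → ℝ, IsBitrajOn f (Icc a b) x t := by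
  choose! g hg hfg using fun x (hx : x ∈ Ico a (f (f c))) => hf.exists_preimage hfa hgt hx
  have hmem (n : ℕ) : g^[n] x ∈ Ico a (f (f c)) := MapsTo.iterate hg n hx
  refine ⟨fun | .ofNat n => f^[n] x | .negSucc n => g^[n + 1] x, rfl, ?_, ?_⟩
  · rintro (n | n)
    · exact hf.iterate_mem (hf.Ico_subset hx) n
    · exact hf.Ico_subset (hmem (n + 1))
  · rintro (n | _ | n)
    · exact (Function.iterate_succ_apply' f n x).symm
    · exact hfg x hx
    · change f (g^[n + 2] x) = g^[n + 1] x
      rw [Function.iterate_succ_apply', hfg _ (hmem _)]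

end SUnimodal

namespace IsBitrajOn

variable {f : ℝ → ℝ} {D : Set ℝ} {x : ℝ} {t : ℤ → ℝ}

theorem map_neg_succ (ht : IsBitrajOn f D x t) (n : ℕ) :
    f (t (-((n + 1 : ℕ) : ℤ))) = t (-(n : ℤ)) := by
  rw [ht.2.2]
  congr 1
  push_cast
  ring

theorem apply_natCast (ht : IsBitrajOn f D x t) (n : ℕ) : t n = f^[n] x := by
  induction n with
  | zero => exact ht.1
  | succ n ih => rw [Function.iterate_succ_apply', ← ih, ht.2.2, Nat.cast_succ]

theorem mem_sAlphaOn_of_tendsto (ht : IsBitrajOn f D x t) {y : ℝ}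
    (h : Tendsto (fun n : ℕ => t (-(n : ℤ))) atTop (𝓝 y)) : y ∈ sAlphaOn f D x := by
  refine ⟨fun n => t (-(n : ℤ)), fun _ => 1, ?_, fun n => ht.2.1 _, fun n hn => ⟨le_rfl, ?_⟩, h⟩
  · simpa using ht.1
  · obtain ⟨m, rfl⟩ := Nat.exists_eq_add_of_le' hn
    exact ht.map_neg_succ m

end IsBitrajOn

namespace SUnimodal

variable {a b c x : ℝ} {f : ℝ → ℝ} {t s : ℤ → ℝ}

theorem bitraj_neg_lt_crit (hf : SUnimodal f a b c) (hfa : f a = a)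
    (hgt : ∀ x ∈ Ioc a c, x < f x) (hx : x < f (f c)) (ht : IsBitrajOn f (Icc a b) x t) (n : ℕ) :
    t (-((n + 1 : ℕ) : ℤ)) < c :=
  (hf.backward_orbit (Y := fun n : ℕ => t (-(n : ℤ))) (k := fun _ => 1) hfa hgt
    (by simpa [ht.1] using hx) (fun n => ht.2.1 _) (fun _ => le_rfl)
    (fun n => ht.map_neg_succ n) n).2.1

theorem tendsto_bitraj_neg (hf : SUnimodal f a b c) (hfa : f a = a)
    (hgt : ∀ x ∈ Ioc a c, x < f x) (hx : x < f (f c)) (ht : IsBitrajOn f (Icc a b) x t) :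
    Tendsto (fun n : ℕ => t (-(n : ℤ))) atTop (𝓝 a) :=
  hf.tendsto_backward_orbit (k := fun _ => 1) hfa hgt
    (by simpa [ht.1] using hx) (fun n => ht.2.1 _) (fun _ => le_rfl)
    (fun n => ht.map_neg_succ n)

theorem bitraj_unique (hf : SUnimodal f a b c) (hfa : f a = a)
    (hgt : ∀ x ∈ Ioc a c, x < f x) (hx : x < f (f c)) (ht : IsBitrajOn f (Icc a b) x t)
    (hs : IsBitrajOn f (Icc a b) x s) : t = s := by
  have hneg (n : ℕ) : t (-(n : ℤ)) = s (-(n : ℤ)) := by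
    induction n with
    | zero => simp [ht.1, hs.1]
    | succ n ih =>
      refine hf.mono.injOn ⟨(ht.2.1 _).1, (hf.bitraj_neg_lt_crit hfa hgt hx ht n).le⟩
        ⟨(hs.2.1 _).1, (hf.bitraj_neg_lt_crit hfa hgt hx hs n).le⟩ ?_
      rw [ht.map_neg_succ, hs.map_neg_succ, ih]
  funext m
  obtain ⟨n, rfl | rfl⟩ := m.eq_nat_or_neg
  · rw [ht.apply_natCast, hs.apply_natCast]
  · exact hneg n

theorem sAlphaOn_subset (hf : SUnimodal f a b c) (hfa : f a = a)
    (hgt : ∀ x ∈ Ioc a c, x < f x) (hx : x < f (f c)) : sAlphaOn f (Icc a b) x ⊆ {a} := by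
  rintro y ⟨Y, k, hY0, hY, hk, hlim⟩
  exact tendsto_nhds_unique hlim <|
    hf.tendsto_backward_orbit (k := fun n => k (n + 1)) hfa hgt (hY0 ▸ hx) hY
      (fun n => (hk (n + 1) n.succ_pos).1) (fun n => (hk (n + 1) n.succ_pos).2)

theorem not_isBitrajOn (hf : SUnimodal f a b c) (hx : f c < x) : ¬ IsBitrajOn f (Icc a b) x t := by
  intro ht
  have h := hf.map_le_map_crit (ht.2.1 (-1))
  rw [ht.2.2, neg_add_cancel, ht.1] at h
  exact h.not_gt hx

theorem sAlphaOn_eq_empty (hf : SUnimodal f a b c) (hx : f c < x) :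
    sAlphaOn f (Icc a b) x = ∅ := by
  refine eq_empty_of_forall_notMem ?_
  rintro y ⟨Y, k, hY0, hY, hk, -⟩
  obtain ⟨hk1, hk2⟩ := hk 1 le_rfl
  have h := hf.iterate_le_map_crit (hY 1) hk1
  rw [hk2, Nat.sub_self, hY0] at h
  exact h.not_gt hx

end SUnimodal

/-- For an S-unimodal map with `f a = a`, `f c < b` and `f x > x` on `(a,c]`:
(i) points of `(c₁, b]` have no bitrajectory and empty special α-limit;
(ii) points of `[a, c₂)` have exactly one bitrajectory, which converges backward
to `a`, and their special α-limit is `{a}`. -/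
theorem sAlpha_levels_minus_one_and_zero
    {a b c : ℝ} {f : ℝ → ℝ} (hf : SUnimodal f a b c)
    (hfa : f a = a) (hfc : f c < b) (hgt : ∀ x ∈ Ioc a c, x < f x) :
    (∀ x ∈ Ioc (f c) b,
      (¬ ∃ t : ℤ → ℝ, IsBitrajOn f (Icc a b) x t) ∧
      sAlphaOn f (Icc a b) x = ∅) ∧
    (∀ x ∈ Ico a (f (f c)),
      (∃! t : ℤ → ℝ, IsBitrajOn f (Icc a b) x t) ∧
      (∀ t : ℤ → ℝ, IsBitrajOn f (Icc a b) x t →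
        Tendsto (fun n : ℕ => t (-(n : ℤ))) atTop (𝓝 a)) ∧
      sAlphaOn f (Icc a b) x = {a}) := by
  refine ⟨fun x hx => ⟨fun ⟨_, ht⟩ => hf.not_isBitrajOn hx.1 ht, hf.sAlphaOn_eq_empty hx.1⟩,
    fun x hx => ?_⟩
  obtain ⟨t, ht⟩ := hf.exists_isBitrajOn hfa hgt hx
  exact ⟨⟨t, ht, fun s hs => hf.bitraj_unique hfa hgt hx.2 hs ht⟩,
    fun s hs => hf.tendsto_bitraj_neg hfa hgt hx.2 hs,
    (hf.sAlphaOn_subset hfa hgt hx.2).antisymm <| singleton_subset_iff.2 <|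
      ht.mem_sAlphaOn_of_tendsto (hf.tendsto_bitraj_neg hfa hgt hx.2 ht)⟩
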